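/- arXiv:1610.04667 — 9 statements merged into one kernel-verified Lean document; each statement's English description precedes it below -/
import Mathlib

section
/- The abelianization of SL(2,ℤ) is cyclic of order 12; that is, the quotient of SL(2,ℤ) by its commutator subgroup is isomorphic to ℤ/12ℤ. -/
open Matrix ModularGroup in
/-- In every commutative quotient of `SL(2, ℤ)`, the image of `S` is the inverse cube of that
of `T`. -/
lemma map_S_mul_map_T_pow_three {A : Type*} [CommGroup A]
    (φ : SpecialLinearGroup (Fin 2) ℤ →* A) : φ S * φ T ^ 3 = 1 := by
  have h : S ^ 2 = (S * T) ^ 3 := by decide +kernel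
  have h' := congrArg φ h
  simp only [map_pow, map_mul, mul_pow] at h'
  rw [pow_succ (φ S) 2, mul_assoc] at h'
  exact left_eq_mul.mp h'

open Matrix ModularGroup in
lemma map_T_pow_twelve {A : Type*} [CommGroup A]
    (φ : SpecialLinearGroup (Fin 2) ℤ →* A) : φ T ^ 12 = 1 := by
  have h : S ^ 4 = 1 := by decide +kernel
  have hS : φ S ^ 4 = 1 := by rw [← map_pow, h, map_one]
  have hST := congrArg (· ^ 4) (map_S_mul_map_T_pow_three φ)
  simpa [mul_pow, hS, ← pow_mul] using hST

/-- The image of `T` generates the abelianization of `SL(2, ℤ)`. -/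
lemma abelianization_SL2Z_exists_zpow
    (x : Abelianization (Matrix.SpecialLinearGroup (Fin 2) ℤ)) :
    ∃ n : ℤ, Abelianization.of ModularGroup.T ^ n = x := by
  obtain ⟨g, rfl⟩ := QuotientGroup.mk_surjective x
  change Abelianization.of g ∈ Subgroup.zpowers (Abelianization.of ModularGroup.T)
  have hg : g ∈ Subgroup.closure {ModularGroup.S, ModularGroup.T} := by
    simp [SpecialLinearGroup.SL2Z_generators]
  suffices Subgroup.closure {ModularGroup.S, ModularGroup.T} ≤
      (Subgroup.zpowers (Abelianization.of ModularGroup.T)).comap Abelianization.of from this hg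
  rw [Subgroup.closure_le]
  rintro _ (rfl | rfl)
  · exact ⟨-3, by
      simpa using (eq_inv_of_mul_eq_one_left (map_S_mul_map_T_pow_three Abelianization.of)).symm⟩
  · exact Subgroup.mem_zpowers _

/-- The polynomial in the entries of a matrix of determinant one which, modulo `12`, gives the
character of `SL(2, ℤ)` sending `T` to `1`. -/
def characterPoly {R : Type*} [CommRing R] (a b c d : R) : R :=
  (1 - c ^ 2) * (b * d + 3 * (c - 1) * d + c + 3) + c * (a + d - 3)

lemma map_characterPoly {R R' : Type*} [CommRing R] [CommRing R'] (f : R →+* R') (a b c d : R) :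
    f (characterPoly a b c d) = characterPoly (f a) (f b) (f c) (f d) := by
  simp [characterPoly, map_ofNat f]

lemma zmod_twelve_ext {x y : ZMod 12}
    (h₃ : ZMod.castHom (show 3 ∣ 12 by decide) (ZMod 3) x = ZMod.castHom (by decide) (ZMod 3) y)
    (h₄ : ZMod.castHom (show 4 ∣ 12 by decide) (ZMod 4) x = ZMod.castHom (by decide) (ZMod 4) y) :
    x = y := by
  revert x y
  decide +kernel

lemma characterPoly_mul_T {a b c d : ZMod 12} (h : a * d - b * c = 1) :
    characterPoly a (a + b) c (c + d) = characterPoly a b c d + 1 := by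
  have key₃ : ∀ a b c d : ZMod 3, a * d - b * c = 1 →
      characterPoly a (a + b) c (c + d) = characterPoly a b c d + 1 := by
    unfold characterPoly; decide +kernel
  have key₄ : ∀ a b c d : ZMod 4, a * d - b * c = 1 →
      characterPoly a (a + b) c (c + d) = characterPoly a b c d + 1 := by
    unfold characterPoly; decide +kernel
  apply zmod_twelve_ext <;> simp only [map_characterPoly, map_add, map_one]
  · exact key₃ _ _ _ _ (by simp only [← map_mul, ← map_sub, h, map_one])
  · exact key₄ _ _ _ _ (by simp only [← map_mul, ← map_sub, h, map_one])

lemma characterPoly_mul_S {a b c d : ZMod 12} (h : a * d - b * c = 1) :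
    characterPoly b (-a) d (-c) = characterPoly a b c d - 3 := by
  have key₃ : ∀ a b c d : ZMod 3, a * d - b * c = 1 →
      characterPoly b (-a) d (-c) = characterPoly a b c d - 3 := by
    unfold characterPoly; decide +kernel
  have key₄ : ∀ a b c d : ZMod 4, a * d - b * c = 1 →
      characterPoly b (-a) d (-c) = characterPoly a b c d - 3 := by
    unfold characterPoly; decide +kernel
  apply zmod_twelve_ext <;> simp only [map_characterPoly, map_neg, map_sub, map_ofNat]
  · exact key₃ _ _ _ _ (by simp only [← map_mul, ← map_sub, h, map_one])
  · exact key₄ _ _ _ _ (by simp only [← map_mul, ← map_sub, h, map_one])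

/-- The value at a matrix in `SL(2, ℤ)` of the character sending `T` to `1`. -/
def characterValue (g : Matrix.SpecialLinearGroup (Fin 2) ℤ) : ZMod 12 :=
  characterPoly (g.1 0 0 : ZMod 12) (g.1 0 1) (g.1 1 0) (g.1 1 1)

lemma characterValue_T : characterValue ModularGroup.T = 1 := by decide +kernel

lemma characterValue_S : characterValue ModularGroup.S = -3 := by decide +kernel

lemma det_cast_eq_one (g : Matrix.SpecialLinearGroup (Fin 2) ℤ) :
    (g.1 0 0 : ZMod 12) * g.1 1 1 - g.1 0 1 * g.1 1 0 = 1 := by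
  have h := g.det_coe
  rw [Matrix.det_fin_two] at h
  exact_mod_cast congrArg (Int.cast : ℤ → ZMod 12) h

lemma characterValue_mul_T (g : Matrix.SpecialLinearGroup (Fin 2) ℤ) :
    characterValue (g * ModularGroup.T) = characterValue g + 1 := by
  rw [characterValue, characterValue, ← characterPoly_mul_T (det_cast_eq_one g)]
  rw [Matrix.SpecialLinearGroup.coe_mul]
  simp [ModularGroup.coe_T, Matrix.mul_apply, Fin.sum_univ_two]

lemma characterValue_mul_S (g : Matrix.SpecialLinearGroup (Fin 2) ℤ) :
    characterValue (g * ModularGroup.S) = characterValue g - 3 := by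
  rw [characterValue, characterValue, ← characterPoly_mul_S (det_cast_eq_one g)]
  rw [Matrix.SpecialLinearGroup.coe_mul]
  simp [ModularGroup.coe_S, Matrix.mul_apply, Fin.sum_univ_two]

lemma characterValue_mul (g h : Matrix.SpecialLinearGroup (Fin 2) ℤ) :
    characterValue (g * h) = characterValue g + characterValue h := by
  have hh : h ∈ Subgroup.closure {ModularGroup.S, ModularGroup.T} := by
    simp [SpecialLinearGroup.SL2Z_generators]
  have h_one : characterValue 1 = 0 := by decide +kernel
  induction hh using Subgroup.closure_induction generalizing g with
  | mem x hx =>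
    rcases hx with rfl | rfl
    · rw [characterValue_mul_S, characterValue_S, sub_eq_add_neg]
    · rw [characterValue_mul_T, characterValue_T]
  | one => simp [h_one]
  | mul x y _ _ hx hy => rw [← mul_assoc, hy, hx, hy x, add_assoc]
  | inv x _ hx =>
    have h₁ := hx (g * x⁻¹)
    have h₂ := hx x⁻¹
    rw [inv_mul_cancel_right] at h₁
    rw [inv_mul_cancel, h_one] at h₂
    linear_combination h₂ - h₁

/-- The character `SL(2, ℤ) → ℤ/12ℤ` sending `T` to `1`. -/
def characterSL2Z : Matrix.SpecialLinearGroup (Fin 2) ℤ →* Multiplicative (ZMod 12) :=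
  MonoidHom.mk' (fun g ↦ Multiplicative.ofAdd (characterValue g)) fun g h ↦ by
    rw [characterValue_mul, ofAdd_add]

lemma lift_characterSL2Z_of_T_zpow (n : ℤ) :
    Abelianization.lift characterSL2Z (Abelianization.of ModularGroup.T ^ n) =
      Multiplicative.ofAdd (n : ZMod 12) := by
  rw [map_zpow, Abelianization.lift_apply_of]
  change Multiplicative.ofAdd (characterValue ModularGroup.T) ^ n = _
  rw [characterValue_T, ← ofAdd_zsmul, zsmul_one]

/-- The abelianization of `SL(2, ℤ)`, i.e. the quotient of `SL(2, ℤ)` by its commutator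
subgroup, is isomorphic to `ℤ/12ℤ`. -/
theorem abelianization_SL2Z_iso_zmod12 :
    Nonempty (Abelianization (Matrix.SpecialLinearGroup (Fin 2) ℤ) ≃* Multiplicative (ZMod 12)) := by
  refine ⟨MulEquiv.ofBijective (Abelianization.lift characterSL2Z) ⟨?_, fun y ↦ ?_⟩⟩
  · rw [injective_iff_map_eq_one]
    intro x hx
    obtain ⟨n, rfl⟩ := abelianization_SL2Z_exists_zpow x
    rw [lift_characterSL2Z_of_T_zpow, ofAdd_eq_one] at hx
    obtain ⟨k, rfl⟩ := (ZMod.intCast_zmod_eq_zero_iff_dvd n 12).mp hx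
    rw [zpow_mul]
    exact_mod_cast congrArg (· ^ k) (map_T_pow_twelve Abelianization.of) |>.trans (one_zpow k)
  · obtain ⟨n, hn⟩ := ZMod.intCast_surjective y.toAdd
    exact ⟨Abelianization.of ModularGroup.T ^ n, by
      rw [lift_characterSL2Z_of_T_zpow, hn, ofAdd_toAdd]⟩
end

section
/- The map χ : SL(2,ℤ) → ℤ/12ℤ defined on a matrix with entries a, b (top row) and c, d (bottom row) by χ = ((1−c²)(bd+3(c−1)d+c+3)+c(a+d−3)) mod 12 is a surjective group homomorphism whose kernel is the commutator subgroup of SL(2,ℤ); consequently χ computes the abelianization map of SL(2,ℤ). -/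
/-- The polynomial in the entries of a `2 × 2` matrix whose reduction modulo `12` is `χ`. -/
def chiPoly {R : Type*} [CommRing R] (a b c d : R) : R :=
  (1 - c ^ 2) * (b * d + 3 * (c - 1) * d + c + 3) + c * (a + d - 3)

@[simp, norm_cast]
theorem chiPoly_intCast {R : Type*} [CommRing R] (a b c d : ℤ) :
    ((chiPoly a b c d : ℤ) : R) = chiPoly (a : R) b c d := by
  simp [chiPoly]

theorem ZMod.intCast_twelve_eq {x y : ℤ} (h₃ : (x : ZMod 3) = y) (h₄ : (x : ZMod 4) = y) :
    (x : ZMod 12) = y := by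
  rw [ZMod.intCast_eq_intCast_iff_dvd_sub] at *
  push_cast at *
  omega

set_option maxRecDepth 100000 in
theorem chiPoly_mul_T_zmod_three : ∀ a b c d : ZMod 3, a * d - b * c = 1 →
    chiPoly a (a + b) c (c + d) = chiPoly a b c d + 1 := by
  unfold chiPoly; decide

set_option maxRecDepth 100000 in
theorem chiPoly_mul_T_zmod_four : ∀ a b c d : ZMod 4, a * d - b * c = 1 →
    chiPoly a (a + b) c (c + d) = chiPoly a b c d + 1 := by
  unfold chiPoly; decide

set_option maxRecDepth 100000 in
theorem chiPoly_mul_S_zmod_three : ∀ a b c d : ZMod 3, a * d - b * c = 1 →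
    chiPoly b (-a) d (-c) = chiPoly a b c d - 3 := by
  unfold chiPoly; decide

set_option maxRecDepth 100000 in
theorem chiPoly_mul_S_zmod_four : ∀ a b c d : ZMod 4, a * d - b * c = 1 →
    chiPoly b (-a) d (-c) = chiPoly a b c d - 3 := by
  unfold chiPoly; decide

theorem intCast_chiPoly_mul_T {a b c d : ℤ} (h : a * d - b * c = 1) :
    ((chiPoly a (a + b) c (c + d) : ℤ) : ZMod 12) = (chiPoly a b c d + 1 : ℤ) := by
  apply ZMod.intCast_twelve_eq
  · simpa using chiPoly_mul_T_zmod_three a b c d (by exact_mod_cast congrArg (Int.cast) h)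
  · simpa using chiPoly_mul_T_zmod_four a b c d (by exact_mod_cast congrArg (Int.cast) h)

theorem intCast_chiPoly_mul_S {a b c d : ℤ} (h : a * d - b * c = 1) :
    ((chiPoly b (-a) d (-c) : ℤ) : ZMod 12) = (chiPoly a b c d - 3 : ℤ) := by
  apply ZMod.intCast_twelve_eq
  · simpa using chiPoly_mul_S_zmod_three a b c d (by exact_mod_cast congrArg (Int.cast) h)
  · simpa using chiPoly_mul_S_zmod_four a b c d (by exact_mod_cast congrArg (Int.cast) h)

/-- The value of `χ` at a matrix in `SL(2,ℤ)`. -/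
def chiFun (M : Matrix.SpecialLinearGroup (Fin 2) ℤ) : ZMod 12 :=
  (chiPoly (M 0 0) (M 0 1) (M 1 0) (M 1 1) : ℤ)

theorem chiFun_one : chiFun 1 = 0 := by
  simp [chiFun, chiPoly]

theorem chiFun_T : chiFun ModularGroup.T = 1 := by
  simp [chiFun, chiPoly, ModularGroup.T]

theorem chiFun_S : chiFun ModularGroup.S = -3 := by
  simp [chiFun, chiPoly, ModularGroup.S]

theorem chiFun_mul_T (M : Matrix.SpecialLinearGroup (Fin 2) ℤ) :
    chiFun (M * ModularGroup.T) = chiFun M + chiFun ModularGroup.T := by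
  have h := M.det_coe
  rw [Matrix.det_fin_two] at h
  rw [chiFun_T]
  simpa [chiFun, ModularGroup.coe_T, Matrix.mul_apply, Fin.sum_univ_two] using
    intCast_chiPoly_mul_T h

theorem chiFun_mul_S (M : Matrix.SpecialLinearGroup (Fin 2) ℤ) :
    chiFun (M * ModularGroup.S) = chiFun M + chiFun ModularGroup.S := by
  have h := M.det_coe
  rw [Matrix.det_fin_two] at h
  rw [chiFun_S, ← sub_eq_add_neg]
  simpa [chiFun, ModularGroup.coe_S, Matrix.mul_apply, Fin.sum_univ_two] using
    intCast_chiPoly_mul_S h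

theorem chiFun_mul (M N : Matrix.SpecialLinearGroup (Fin 2) ℤ) :
    chiFun (M * N) = chiFun M + chiFun N := by
  have hN : N ∈ Subgroup.closure {ModularGroup.S, ModularGroup.T} := by
    rw [SpecialLinearGroup.SL2Z_generators]; trivial
  induction hN using Subgroup.closure_induction generalizing M with
  | mem x hx =>
    rcases hx with rfl | rfl
    · exact chiFun_mul_S M
    · exact chiFun_mul_T M
  | one => simp [chiFun_one]
  | mul x y _ _ hx hy => rw [← mul_assoc, hy, hx, hy x, add_assoc]
  | inv x _ hx =>
    have h₁ := hx (M * x⁻¹)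
    have h₂ := hx x⁻¹
    rw [inv_mul_cancel_right] at h₁
    rw [inv_mul_cancel, chiFun_one] at h₂
    linear_combination h₂ - h₁

/-- The homomorphism `χ : SL(2,ℤ) → ℤ/12ℤ`. -/
def chiHom : Matrix.SpecialLinearGroup (Fin 2) ℤ →* Multiplicative (ZMod 12) where
  toFun M := Multiplicative.ofAdd (chiFun M)
  map_one' := by rw [chiFun_one]; rfl
  map_mul' M N := by rw [chiFun_mul]; rfl

theorem chiHom_T : chiHom ModularGroup.T = Multiplicative.ofAdd 1 :=
  congrArg Multiplicative.ofAdd chiFun_T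

theorem chiHom_T_zpow (k : ℤ) :
    chiHom (ModularGroup.T ^ k) = Multiplicative.ofAdd (k : ZMod 12) := by
  rw [map_zpow, chiHom_T, ← ofAdd_zsmul, zsmul_one]

theorem chiHom_surjective : Function.Surjective chiHom := fun x => by
  obtain ⟨k, hk⟩ := ZMod.intCast_surjective x.toAdd
  exact ⟨ModularGroup.T ^ k, by rw [chiHom_T_zpow, hk]; rfl⟩

theorem S_mul_T_pow_three : (ModularGroup.S * ModularGroup.T) ^ 3 = ModularGroup.S ^ 2 := by
  decide

theorem S_pow_four : ModularGroup.S ^ 4 = 1 := by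
  decide

section Abelian

variable {A : Type*} [CommGroup A] (f : Matrix.SpecialLinearGroup (Fin 2) ℤ →* A)

theorem map_S_eq_map_T_zpow : f ModularGroup.S = f ModularGroup.T ^ (-3 : ℤ) := by
  have h := congrArg f S_mul_T_pow_three
  rw [map_pow, map_mul, map_pow, mul_pow, pow_succ, mul_assoc, mul_eq_left] at h
  rw [zpow_neg]
  exact eq_inv_of_mul_eq_one_left (mod_cast h)

theorem map_T_pow_twelve_s1 : f ModularGroup.T ^ 12 = 1 := by
  have h := congrArg f S_pow_four
  rw [map_pow, map_one, map_S_eq_map_T_zpow, ← zpow_natCast, ← zpow_mul] at h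
  norm_num at h
  exact_mod_cast h

theorem exists_map_eq_map_T_zpow (M : Matrix.SpecialLinearGroup (Fin 2) ℤ) :
    ∃ k : ℤ, f M = f (ModularGroup.T ^ k) := by
  have hM : f M ∈ (Subgroup.closure {ModularGroup.S, ModularGroup.T}).map f := by
    rw [SpecialLinearGroup.SL2Z_generators]; exact ⟨M, trivial, rfl⟩
  have hle : (Subgroup.closure {ModularGroup.S, ModularGroup.T}).map f ≤
      Subgroup.zpowers (f ModularGroup.T) := by
    rw [Subgroup.map_le_iff_le_comap, Subgroup.closure_le]
    rintro x (rfl | rfl)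
    · exact ⟨-3, (map_S_eq_map_T_zpow f).symm⟩
    · exact Subgroup.mem_zpowers _
  obtain ⟨k, hk⟩ := hle hM
  exact ⟨k, by rw [map_zpow]; exact hk.symm⟩

end Abelian

theorem chiHom_ker : chiHom.ker = commutator (Matrix.SpecialLinearGroup (Fin 2) ℤ) := by
  refine le_antisymm (fun M hM => ?_) (Abelianization.commutator_subset_ker chiHom)
  obtain ⟨k, hk⟩ := exists_map_eq_map_T_zpow Abelianization.of M
  rw [← Abelianization.ker_of, MonoidHom.mem_ker, hk]
  have hχ : chiHom M = chiHom (ModularGroup.T ^ k) := by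
    simpa using congrArg (Abelianization.lift chiHom) hk
  rw [MonoidHom.mem_ker.mp hM, chiHom_T_zpow, eq_comm, ofAdd_eq_one,
    ZMod.intCast_zmod_eq_zero_iff_dvd] at hχ
  obtain ⟨m, rfl⟩ := hχ
  rw [map_zpow, zpow_mul]
  have := map_T_pow_twelve_s1 (Abelianization.of (G := Matrix.SpecialLinearGroup (Fin 2) ℤ))
  rw [← zpow_natCast] at this
  rw [this, one_zpow]


/-- The map `χ : SL(2,ℤ) → ℤ/12ℤ` given on `M = [[a,b],[c,d]]` by
`χ(M) = (1−c²)(bd+3(c−1)d+c+3)+c(a+d−3) mod 12` is a surjective group homomorphism whose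
kernel is the commutator subgroup of `SL(2,ℤ)`; consequently `χ` computes the abelianization
map of `SL(2,ℤ)`. -/
theorem chi_SL2Z_abelianization :
    ∃ χ : Matrix.SpecialLinearGroup (Fin 2) ℤ →* Multiplicative (ZMod 12),
      (∀ M : Matrix.SpecialLinearGroup (Fin 2) ℤ,
        χ M = Multiplicative.ofAdd
          ((((1 - (M 1 0) ^ 2) * ((M 0 1) * (M 1 1) + 3 * ((M 1 0) - 1) * (M 1 1)
              + (M 1 0) + 3) + (M 1 0) * ((M 0 0) + (M 1 1) - 3) : ℤ) : ZMod 12))) ∧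
      Function.Surjective χ ∧
      χ.ker = commutator (Matrix.SpecialLinearGroup (Fin 2) ℤ) := by
  exact ⟨chiHom, fun _ => rfl, chiHom_surjective, chiHom_ker⟩
end

section
/- In any group, if elements a and b satisfy the braid relation a·b·a = b·a·b, then (b⁻¹·b⁻¹·a·b)·(b⁻¹·a·b)·(a·b) = b⁻¹·a·b³ = (b⁻¹·a·b)·(a·b)·(b⁻¹·b⁻¹·a·b)⁻¹. (In the paper's notation, G₂ᵒᵖᵖ·B₂ᵒᵖᵖ·A₂ᵒᵖᵖ = B₂ᵒᵖᵖ·A₂ᵒᵖᵖ·(G₂ᵒᵖᵖ)⁻¹ as elements of Br₃.) -/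
/-- In any group, if `a` and `b` satisfy the braid relation, then
`(b⁻¹*b⁻¹*a*b) * (b⁻¹*a*b) * (a*b) = b⁻¹*a*b^3 = (b⁻¹*a*b) * (a*b) * (b⁻¹*b⁻¹*a*b)⁻¹`.
(In the paper's notation, `G₂ᵒᵖᵖ * B₂ᵒᵖᵖ * A₂ᵒᵖᵖ = B₂ᵒᵖᵖ * A₂ᵒᵖᵖ * (G₂ᵒᵖᵖ)⁻¹` in `Br₃`.) -/
theorem g2opp_b2opp_a2opp_identity {G : Type*} [Group G] (a b : G)
    (hbraid : a * b * a = b * a * b) :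
    (b⁻¹ * b⁻¹ * a * b) * (b⁻¹ * a * b) * (a * b) = b⁻¹ * a * b ^ 3 ∧
    b⁻¹ * a * b ^ 3 = (b⁻¹ * a * b) * (a * b) * (b⁻¹ * b⁻¹ * a * b)⁻¹ := by
  have hconj : a * (a * b * a) = a * b * a * b := by
    conv_lhs => rw [hbraid]
    simp only [mul_assoc]
  refine ⟨?_, by group⟩
  calc (b⁻¹ * b⁻¹ * a * b) * (b⁻¹ * a * b) * (a * b)
      = b⁻¹ * b⁻¹ * (a * (a * (b * a * b))) := by group
    _ = b⁻¹ * b⁻¹ * (a * b * a * b * b) := by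
      rw [← hbraid, hconj, ← mul_assoc a, hconj]
    _ = b⁻¹ * a * b ^ 3 := by rw [hbraid]; simp [pow_succ, mul_assoc]
end

section
/- In any group, if elements a and b satisfy the braid relation a·b·a = b·a·b, then (b⁻¹·b⁻¹·a·b)·(b⁻¹·a·b)·(a·b)·(b⁻¹·b⁻¹·a·b) = (b⁻¹·a·b)·(a·b). (In the paper's notation, G₂ᵒᵖᵖ·B₂ᵒᵖᵖ·A₂ᵒᵖᵖ·G₂ᵒᵖᵖ = B₂ᵒᵖᵖ·A₂ᵒᵖᵖ as elements of Br₃.) -/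
/-- In any group, if `a` and `b` satisfy the braid relation, then
`(b⁻¹*b⁻¹*a*b) * (b⁻¹*a*b) * (a*b) * (b⁻¹*b⁻¹*a*b) = (b⁻¹*a*b) * (a*b)`.
(In the paper's notation, `G₂ᵒᵖᵖ * B₂ᵒᵖᵖ * A₂ᵒᵖᵖ * G₂ᵒᵖᵖ = B₂ᵒᵖᵖ * A₂ᵒᵖᵖ` in `Br₃`.) -/
theorem g2opp_conjugation_identity {G : Type*} [Group G] (a b : G)
    (hbraid : a * b * a = b * a * b) :
    (b⁻¹ * b⁻¹ * a * b) * (b⁻¹ * a * b) * (a * b) * (b⁻¹ * b⁻¹ * a * b) =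
      (b⁻¹ * a * b) * (a * b) := by
  have hconj : b * a * b⁻¹ = a⁻¹ * b * a :=
    calc
      b * a * b⁻¹ = a⁻¹ * (a * b * a) * b⁻¹ := by group
      _ = a⁻¹ * b * a := by rw [hbraid]; group
  calc
    _ = b⁻¹ * b⁻¹ * a * a * (b * a * b⁻¹) * a * b := by group
    _ = b⁻¹ * b⁻¹ * (a * b * a) * a * b := by rw [hconj]; group
    _ = (b⁻¹ * a * b) * (a * b) := by rw [hbraid]; group
end

section
/- In any group, if elements a and b satisfy the braid relation a·b·a = b·a·b, then for every natural number k, (b·a·b⁻²)^k·(b·a·b⁻¹)·(b·a)·(a·b·a)·(b⁻²·a·b)^k·(b⁻¹·a·b)·(a·b)·(a·b·a) = (a·b)⁶. (This is the braid-level statement that for every k the sequence of pieces [(G₂ᵒᵖᵖb)^k, B₂ᵒᵖᵖb, A₂ᵒᵖᵖb, A₁×A₁, (G₂ᵒᵖᵖ)^k, B₂ᵒᵖᵖ, A₂ᵒᵖᵖ, A₁×A₁] is a valid single-layered pizza.) -/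
/-- Conjugation by the half twist `a * b * a` sends `a` to `b`. -/
theorem semiconjBy_halfTwist_left {G : Type*} [Group G] {a b : G}
    (h : a * b * a = b * a * b) : SemiconjBy (a * b * a) a b := by
  calc a * b * a * a = b * a * b * a := by rw [h]
    _ = b * (a * b * a) := by group

/-- Conjugation by the half twist `a * b * a` sends `b` to `a`. -/
theorem semiconjBy_halfTwist_right {G : Type*} [Group G] {a b : G}
    (h : a * b * a = b * a * b) : SemiconjBy (a * b * a) b a := by
  calc a * b * a * b = a * (b * a * b) := by group
    _ = a * (a * b * a) := by rw [h]

/-- If `p` conjugates `y` to `x⁻¹`, then `x ^ k` and `y ^ k` cancel around `p`. -/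
theorem SemiconjBy.pow_mul_mul_pow {G : Type*} [Group G] {p x y : G}
    (h : SemiconjBy p y x⁻¹) (k : ℕ) : x ^ k * p * y ^ k = p := by
  rw [mul_assoc, (h.pow_right k).eq, inv_pow, mul_inv_cancel_left]


/-- In any group, if `a` and `b` satisfy the braid relation, then for every natural number `k`,
`(b*a*b⁻²)^k * (b*a*b⁻¹) * (b*a) * (a*b*a) * (b⁻²*a*b)^k * (b⁻¹*a*b) * (a*b) * (a*b*a) = (a*b)⁶`.
(This is the braid-level statement that for every `k` the sequence of pieces
`[(G₂ᵒᵖᵖb)^k, B₂ᵒᵖᵖb, A₂ᵒᵖᵖb, A₁×A₁, (G₂ᵒᵖᵖ)^k, B₂ᵒᵖᵖ, A₂ᵒᵖᵖ, A₁×A₁]`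
is a valid single-layered pizza.) -/
theorem infinite_pizza_family {G : Type*} [Group G] (a b : G)
    (hbraid : a * b * a = b * a * b) (k : ℕ) :
    (b * a * b⁻¹ * b⁻¹) ^ k * (b * a * b⁻¹) * (b * a) * (a * b * a) *
      (b⁻¹ * b⁻¹ * a * b) ^ k * (b⁻¹ * a * b) * (a * b) * (a * b * a) = (a * b) ^ 6 := by
  have ha := semiconjBy_halfTwist_left hbraid
  have hb := semiconjBy_halfTwist_right hbraid
  have hp : SemiconjBy (b * a * a * (a * b * a)) (b⁻¹ * b⁻¹ * a * b)
      (b * a * b⁻¹ * b⁻¹)⁻¹ := by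
    have hy : SemiconjBy (a * b * a) (b⁻¹ * b⁻¹ * a * b) (a⁻¹ * a⁻¹ * b * a) :=
      ((hb.inv_right.mul_right hb.inv_right).mul_right ha).mul_right hb
    refine SemiconjBy.mul_left ?_ hy
    rw [SemiconjBy]
    simp [mul_assoc]
  have hz : SemiconjBy (a * b * a) b⁻¹ a⁻¹ := hb.inv_right
  calc _ = (b * a * b⁻¹ * b⁻¹) ^ k * (b * a * a * (a * b * a)) * (b⁻¹ * b⁻¹ * a * b) ^ k *
        (b⁻¹ * (a * b * a) * b * (a * b * a)) := by
        simp only [mul_assoc, inv_mul_cancel_left]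
    _ = b * a * a * (a * b * a * b⁻¹) * (a * b * a) * (b * (a * b * a)) := by
        rw [hp.pow_mul_mul_pow k]
        simp only [mul_assoc]
    _ = b * a * (a * b * a) * (a * b * a * b) * (a * b * a) := by
        rw [hz.eq]
        simp only [mul_assoc, mul_inv_cancel_left]
    _ = b * a * (a * b * a * a) * (a * b * a) * (a * b * a) := by
        rw [hb.eq]
        simp only [mul_assoc]
    _ = b * a * b * (a * b * a) * (a * b * a) * (a * b * a) := by
        rw [ha.eq]
        simp only [mul_assoc]
    _ = a * b * a * (b * a * b) * (a * b * a) * (b * a * b) := by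
        rw [← hbraid]
    _ = (a * b) ^ 6 := by
        simp only [pow_succ, pow_zero, one_mul, mul_assoc]
end

section
/- In any group, if elements a and b satisfy the braid relation a·b·a = b·a·b, then (b·a·b·a)³ = (a·b)⁶. (This is the braid-level condition for the pizza [A₂, A₂, A₂], witnessing the degeneration of ℂP² into three Schubert surfaces.) -/
/-- In any group, if `a` and `b` satisfy the braid relation, then `(b*a*b*a)³ = (a*b)⁶`.
(Braid-level condition for the pizza `[A₂, A₂, A₂]`, witnessing the degeneration of `ℂP²`
into three Schubert surfaces.) -/
theorem pizza_A2_A2_A2 {G : Type*} [Group G] (a b : G)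
    (hbraid : a * b * a = b * a * b) :
    (b * a * b * a) ^ 3 = (a * b) ^ 6 := by
  have hcube : (b * a) ^ 3 = (a * b) ^ 3 := by
    calc
      (b * a) ^ 3 = (b * a * b) * (a * b * a) := by
        simp only [pow_succ, pow_zero, one_mul, mul_assoc]
      _ = (a * b * a) * (b * a * b) := by rw [hbraid]
      _ = (a * b) ^ 3 := by
        simp only [pow_succ, pow_zero, one_mul, mul_assoc]
  calc
    (b * a * b * a) ^ 3 = ((b * a) ^ 3) ^ 2 := by
      simp only [pow_succ, pow_zero, one_mul, mul_assoc]
    _ = ((a * b) ^ 3) ^ 2 := by rw [hcube]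
    _ = (a * b) ^ 6 := (pow_mul _ 3 2).symm
end

section
/- In any group, if elements a and b satisfy the braid relation a·b·a = b·a·b, then (b·a·b·a)·(b·a·b·a)·(b·a)·(b·a) = (a·b)⁶. (This is the braid-level condition for the pizza [A₂, A₂, A₂ᵒᵖᵖb, A₂ᵒᵖᵖb] from the paper's classification of simply laced pizzas.) -/
/-- In any group, if `a` and `b` satisfy the braid relation, then
`(b*a*b*a) * (b*a*b*a) * (b*a) * (b*a) = (a*b)⁶`.
(Braid-level condition for the pizza `[A₂, A₂, A₂ᵒᵖᵖb, A₂ᵒᵖᵖb]`.) -/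
theorem pizza_A2_A2_A2oppb_A2oppb {G : Type*} [Group G] (a b : G)
    (hbraid : a * b * a = b * a * b) :
    (b * a * b * a) * (b * a * b * a) * (b * a) * (b * a) = (a * b) ^ 6 := by
  have hcube : (b * a) ^ 3 = (a * b) ^ 3 := calc
    (b * a) ^ 3 = (b * a * b) * (a * b * a) := by simp only [pow_succ, pow_zero, one_mul, mul_assoc]
    _ = (a * b * a) * (b * a * b) := by rw [hbraid]
    _ = (a * b) ^ 3 := by simp only [pow_succ, pow_zero, one_mul, mul_assoc]
  calc (b * a * b * a) * (b * a * b * a) * (b * a) * (b * a) = ((b * a) ^ 3) ^ 2 := by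
        simp only [pow_succ, pow_zero, one_mul, mul_assoc]
    _ = (a * b) ^ 6 := by rw [hcube, ← pow_mul]
end

section
/- In any group, if elements a and b satisfy the braid relation a·b·a = b·a·b, then (a·b·a)·(a·b·a)·(b·a·b·a)·(b·a) = (a·b)⁶. (This is the braid-level condition for the pizza [A₁×A₁, A₁×A₁, A₂, A₂ᵒᵖᵖb] from the paper's classification of simply laced pizzas.) -/
/-- In any group, if `a` and `b` satisfy the braid relation, then
`(a*b*a) * (a*b*a) * (b*a*b*a) * (b*a) = (a*b)⁶`.
(Braid-level condition for the pizza `[A₁×A₁, A₁×A₁, A₂, A₂ᵒᵖᵖb]`.) -/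
theorem pizza_A1A1_A1A1_A2_A2oppb {G : Type*} [Group G] (a b : G)
    (hbraid : a * b * a = b * a * b) :
    (a * b * a) * (a * b * a) * (b * a * b * a) * (b * a) = (a * b) ^ 6 := by
  calc (a * b * a) * (a * b * a) * (b * a * b * a) * (b * a)
      = (a * b * a) * (a * b * a) * ((b * a * b) * (a * b * a)) := by
        simp only [mul_assoc]
    _ = (a * b * a) * (b * a * b) * ((a * b * a) * (b * a * b)) := by
        simp only [hbraid]
    _ = (a * b) ^ 6 := by
        simp only [pow_succ, pow_zero, one_mul, mul_assoc]
end

section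
/- Let (W, S) be a Coxeter system with length function ℓ, and let t, t' ∈ W be reflections such that the product t·t' has order 3; set t'' = t·t'·t. Suppose w, w̃ ∈ W and that for two distinct elements r₁, r₂ of the set {t, t', t''} we have both ℓ(w·rᵢ) = ℓ(w) + 1 (i.e. w·rᵢ covers w in Bruhat order) and w·rᵢ is covered by w̃ (i.e. there is a reflection uᵢ with w̃ = w·rᵢ·uᵢ and ℓ(w̃) = ℓ(w·rᵢ) + 1), for i = 1, 2. Then for the remaining third element r₃ of {t, t', t''} one has ℓ(w·r₃) ≠ ℓ(w) + 1, i.e. w·r₃ does not cover w. -/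
namespace CoxeterSystem

variable {B W : Type*} [Group W] {M : CoxeterMatrix B} (cs : CoxeterSystem M W)

open Classical in
/-- The action of a simple reflection on signed group elements: conjugation, with a change of sign
exactly at the simple reflection itself. -/
noncomputable def signedConj (i : B) : Function.End (W × ZMod 2) :=
  fun p ↦ (cs.simple i * p.1 * cs.simple i, p.2 + if p.1 = cs.simple i then 1 else 0)

theorem simple_mul_pow_eq (i j : B) (k : ℕ) :
    cs.simple j * (cs.simple i * cs.simple j) ^ k =
      ((cs.simple i * cs.simple j) ^ k)⁻¹ * cs.simple j := by
  have h : SemiconjBy (cs.simple j) (cs.simple i * cs.simple j)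
      (cs.simple i * cs.simple j)⁻¹ := by
    simp [SemiconjBy, mul_assoc]
  rw [← inv_pow]
  exact h.pow_right k

theorem conj_pow_eq_right_iff (i j : B) (k : ℕ) (t : W) :
    (cs.simple i * cs.simple j) ^ k * t * ((cs.simple i * cs.simple j) ^ k)⁻¹ = cs.simple j ↔
      t = ((cs.simple i * cs.simple j) ^ (2 * k))⁻¹ * cs.simple j := by
  rw [mul_inv_eq_iff_eq_mul, simple_mul_pow_eq, ← eq_inv_mul_iff_mul_eq, ← mul_assoc,
    ← mul_inv_rev, ← pow_add, two_mul]

theorem conj_pow_eq_left_iff (i j : B) (k : ℕ) (t : W) :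
    cs.simple j * ((cs.simple i * cs.simple j) ^ k * t * ((cs.simple i * cs.simple j) ^ k)⁻¹) *
        cs.simple j = cs.simple i ↔
      t = ((cs.simple i * cs.simple j) ^ (2 * k + 1))⁻¹ * cs.simple j := by
  have h : cs.simple j * ((cs.simple i * cs.simple j) ^ k * t *
      ((cs.simple i * cs.simple j) ^ k)⁻¹) * cs.simple j = cs.simple i ↔
      (cs.simple i * cs.simple j) ^ (k + 1) * t * ((cs.simple i * cs.simple j) ^ (k + 1))⁻¹ =
        cs.simple i := by
    rw [pow_succ' _ k, mul_inv_rev, mul_inv_rev, inv_simple, inv_simple]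
    constructor
    · intro e
      calc _ = cs.simple i * (cs.simple j * ((cs.simple i * cs.simple j) ^ k * t *
            ((cs.simple i * cs.simple j) ^ k)⁻¹) * cs.simple j) * cs.simple i := by
              simp only [mul_assoc]
        _ = _ := by rw [e]; simp
    · intro e
      calc _ = cs.simple i * (cs.simple i * cs.simple j * (cs.simple i * cs.simple j) ^ k * t *
            (((cs.simple i * cs.simple j) ^ k)⁻¹ * (cs.simple j * cs.simple i))) * cs.simple i := by
              simp [mul_assoc]
        _ = _ := by rw [e]; simp
  have h' : cs.simple i * (cs.simple i * cs.simple j) ^ (k + 1) =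
      ((cs.simple i * cs.simple j) ^ k)⁻¹ * cs.simple j := by
    rw [← simple_mul_pow_eq, pow_succ']
    simp [← mul_assoc]
  rw [h, mul_inv_eq_iff_eq_mul, h', ← eq_inv_mul_iff_mul_eq, ← mul_assoc,
    ← mul_inv_rev, ← pow_add]
  ring_nf

open Classical in
theorem signedConj_mul_pow_apply (i j : B) (m : ℕ) (p : W × ZMod 2) :
    (cs.signedConj i * cs.signedConj j) ^ m • p =
      ((cs.simple i * cs.simple j) ^ m * p.1 * ((cs.simple i * cs.simple j) ^ m)⁻¹,
        p.2 + ∑ k ∈ Finset.range (2 * m),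
          if p.1 = ((cs.simple i * cs.simple j) ^ k)⁻¹ * cs.simple j then 1 else 0) := by
  induction m with
  | zero => simp
  | succ m ih =>
    rw [pow_succ', mul_smul, ih, mul_smul, Function.End.smul_def, Function.End.smul_def,
      signedConj, signedConj]
    ext
    · simp [pow_succ', mul_assoc]
    · simp only [conj_pow_eq_right_iff, conj_pow_eq_left_iff]
      rw [show 2 * (m + 1) = 2 * m + 1 + 1 by ring, Finset.sum_range_succ, Finset.sum_range_succ]
      ring

theorem isLiftable_signedConj : M.IsLiftable cs.signedConj := by
  classical
  intro i j
  funext p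
  have h := cs.signedConj_mul_pow_apply i j (M i j) p
  rw [Function.End.smul_def] at h
  rw [h, two_mul, Finset.sum_range_add]
  simp only [pow_add, simple_mul_simple_pow, one_mul, inv_one, mul_one, CharTwo.add_self_eq_zero,
    add_zero]
  rfl

/-- The action of `W` on signed elements of `W`. -/
noncomputable def signedConjHom : W →* Function.End (W × ZMod 2) :=
  cs.lift ⟨cs.signedConj, cs.isLiftable_signedConj⟩

/-- The reflection cocycle: for a reflection `t`, its value at `(w, t)` is `1` exactly if `t` is a
right inversion of `w`. -/
noncomputable def inversionParity (w t : W) : ZMod 2 := (cs.signedConjHom w • (t, (0 : ZMod 2))).2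

open Classical in
theorem signedConjHom_simple_smul (i : B) (p : W × ZMod 2) :
    cs.signedConjHom (cs.simple i) • p =
      (cs.simple i * p.1 * cs.simple i, p.2 + if p.1 = cs.simple i then 1 else 0) := by
  rw [signedConjHom, lift_apply_simple]
  rfl

theorem signedConjHom_smul (w : W) (p : W × ZMod 2) :
    cs.signedConjHom w • p = (w * p.1 * w⁻¹, p.2 + cs.inversionParity w p.1) := by
  induction w using cs.simple_induction_left generalizing p with
  | one => simp [inversionParity]
  | mul_simple_left w i ih =>
    have h : cs.inversionParity (cs.simple i * w) p.1 =
        (cs.signedConjHom (cs.simple i) • cs.signedConjHom w • (p.1, (0 : ZMod 2))).2 := by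
      rw [inversionParity, map_mul, mul_smul]
    rw [h, map_mul, mul_smul, ih, ih, signedConjHom_simple_smul, signedConjHom_simple_smul]
    simp [mul_assoc, add_assoc]

theorem inversionParity_mul (x y t : W) :
    cs.inversionParity (x * y) t =
      cs.inversionParity y t + cs.inversionParity x (y * t * y⁻¹) := by
  rw [inversionParity, map_mul, mul_smul, signedConjHom_smul, signedConjHom_smul]
  simp

@[simp]
theorem inversionParity_one (t : W) : cs.inversionParity 1 t = 0 := by
  simp [inversionParity]

open Classical in
theorem inversionParity_simple (i : B) (t : W) :
    cs.inversionParity (cs.simple i) t = if t = cs.simple i then 1 else 0 := by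
  rw [inversionParity, signedConjHom_simple_smul, zero_add]

theorem IsReflection.inversionParity_self {cs : CoxeterSystem M W} {t : W}
    (ht : cs.IsReflection t) : cs.inversionParity t t = 1 := by
  obtain ⟨u, i, rfl⟩ := ht
  have h := cs.inversionParity_mul u u⁻¹ (u * cs.simple i * u⁻¹)
  have e : u⁻¹ * (u * cs.simple i * u⁻¹) * u⁻¹⁻¹ = cs.simple i := by group
  rw [mul_inv_cancel, inversionParity_one, e] at h
  rw [inversionParity_mul, e, inversionParity_mul, inversionParity_simple, if_pos rfl,
    mul_inv_cancel_right, add_left_comm, ← h, add_zero]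

theorem mem_rightInvSeq_of_inversionParity_ne_zero (ω : List B) (t : W)
    (h : cs.inversionParity (cs.wordProd ω) t ≠ 0) : t ∈ cs.rightInvSeq ω := by
  induction ω with
  | nil => simp at h
  | cons i ω ih =>
    rw [rightInvSeq, List.mem_cons]
    by_contra! hc
    apply h
    rw [wordProd_cons, inversionParity_mul, inversionParity_simple, if_neg, add_zero]
    · by_contra h'
      exact hc.2 (ih h')
    · intro e
      apply hc.1
      rw [← e]
      group

theorem length_mul_lt_of_inversionParity_ne_zero {w t : W} (h : cs.inversionParity w t ≠ 0) :
    cs.length (w * t) < cs.length w := by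
  obtain ⟨ω, hω, rfl⟩ := cs.exists_isReduced w
  exact (cs.isRightInversion_of_mem_rightInvSeq hω
    (cs.mem_rightInvSeq_of_inversionParity_ne_zero ω t h)).2

theorem IsReflection.inversionParity_mul_self {cs : CoxeterSystem M W} {t : W}
    (ht : cs.IsReflection t) (w : W) :
    cs.inversionParity (w * t) t = 1 + cs.inversionParity w t := by
  rw [cs.inversionParity_mul, ht.inversionParity_self, mul_inv_cancel_right]

theorem IsReflection.inversionParity_ne_zero_iff {cs : CoxeterSystem M W} {t : W}
    (ht : cs.IsReflection t) (w : W) :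
    cs.inversionParity w t ≠ 0 ↔ cs.length (w * t) < cs.length w := by
  refine ⟨cs.length_mul_lt_of_inversionParity_ne_zero, fun h h0 ↦ ?_⟩
  have h1 : cs.inversionParity (w * t) t ≠ 0 := by
    rw [ht.inversionParity_mul_self, h0]
    decide
  have h2 := cs.length_mul_lt_of_inversionParity_ne_zero h1
  rw [mul_assoc, ht.mul_self, mul_one] at h2
  omega

theorem IsReflection.inversionParity_eq_zero_iff {cs : CoxeterSystem M W} {t : W}
    (ht : cs.IsReflection t) (w : W) :
    cs.inversionParity w t = 0 ↔ cs.length w < cs.length (w * t) := by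
  rw [← not_iff_not, ← ne_eq, ht.inversionParity_ne_zero_iff]
  have := ht.length_mul_left_ne w
  omega

/-- In a nontrivial set of reflections that is stable under its own conjugations, not every
reflection is a right inversion of every other one. -/
theorem exists_inversionParity_eq_zero (T : Set W) (hT : T.Nontrivial)
    (hinv : ∀ x ∈ T, x * x = 1) (hconj : ∀ x ∈ T, ∀ y ∈ T, x * y * x ∈ T)
    {r : W} (hr : cs.IsReflection r) (hrT : r ∈ T) :
    ∃ x ∈ T, ∃ y ∈ T, cs.inversionParity x y = 0 := by
  obtain ⟨u, i, rfl⟩ := hr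
  induction u using cs.simple_induction_left generalizing T with
  | one =>
    rw [one_mul, inv_one, mul_one] at hrT
    obtain ⟨y, hy, hne⟩ := hT.exists_ne (cs.simple i)
    exact ⟨_, hrT, y, hy, by rw [inversionParity_simple, if_neg hne]⟩
  | mul_simple_left u j ih =>
    by_cases hj : cs.simple j ∈ T
    · obtain ⟨y, hy, hne⟩ := hT.exists_ne (cs.simple j)
      exact ⟨_, hj, y, hy, by rw [inversionParity_simple, if_neg hne]⟩
    · have hc (x y : W) : cs.simple j * x * cs.simple j * (cs.simple j * y * cs.simple j) *
          (cs.simple j * x * cs.simple j) = cs.simple j * (x * y * x) * cs.simple j := by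
        simp [mul_assoc]
      have hs (x : W) : cs.simple j * (cs.simple j * x * cs.simple j) * cs.simple j = x := by
        simp [mul_assoc]
      obtain ⟨x, hx, y, hy, h⟩ := ih {x | cs.simple j * x * cs.simple j ∈ T} (by
          obtain ⟨x, hx, y, hy, hne⟩ := hT
          refine ⟨cs.simple j * x * cs.simple j, by rwa [Set.mem_ofPred_eq, hs],
            cs.simple j * y * cs.simple j, by rwa [Set.mem_ofPred_eq, hs], by simpa using hne⟩) (by
          intro x hx
          have := hinv _ hx
          rwa [show cs.simple j * x * cs.simple j * (cs.simple j * x * cs.simple j) =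
            cs.simple j * (x * x) * cs.simple j by simp [mul_assoc],
            mul_eq_one_iff_eq_inv, inv_simple, mul_eq_left] at this) (by
          intro x hx y hy
          rw [Set.mem_ofPred_eq, ← hc]
          exact hconj _ hx _ hy) (by simpa [mul_assoc] using hrT)
      refine ⟨_, hx, _, hy, ?_⟩
      have hxx : cs.simple j * x * cs.simple j * (cs.simple j * x * cs.simple j) = 1 := hinv _ hx
      have hx' : x⁻¹ = x := by
        rw [show cs.simple j * x * cs.simple j * (cs.simple j * x * cs.simple j) =
            cs.simple j * (x * x) * cs.simple j by simp [mul_assoc],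
            mul_eq_one_iff_eq_inv, inv_simple, mul_eq_left] at hxx
        exact inv_eq_of_mul_eq_one_left hxx
      rw [inversionParity_mul, inversionParity_simple, inv_simple, hs, inversionParity_mul, h,
        inversionParity_simple, hx', if_neg, if_neg]
      · simp
      · intro e
        have := hconj _ hx _ hy
        rw [hc, e] at this
        exact hj (by simpa using this)
      · intro e
        exact hj (e ▸ hy)

/-- If `w * x`, `w * y` and `w * (x * y * x)` all cover `w`, where `x` and `y` are reflections
satisfying a braid relation of length three, then `y` is a right inversion of `x`. -/
theorem IsReflection.inversionParity_ne_zero_of_covers {cs : CoxeterSystem M W} {x y w : W}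
    (hx : cs.IsReflection x) (hy : cs.IsReflection y) (hb : x * y * x = y * x * y)
    (hwx : cs.length (w * x) = cs.length w + 1) (hwy : cs.length (w * y) = cs.length w + 1)
    (hwz : cs.length (w * (x * y * x)) = cs.length w + 1) : cs.inversionParity x y ≠ 0 := by
  have hz : cs.IsReflection (x * y * x) := by
    have := hy.conj x
    rwa [hx.inv] at this
  have wx : cs.inversionParity w x = 0 := (hx.inversionParity_eq_zero_iff w).2 (by omega)
  have wz : cs.inversionParity w (x * y * x) = 0 := (hz.inversionParity_eq_zero_iff w).2 (by omega)
  intro h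
  have h1 : cs.length (w * x) < cs.length (w * x * y) := by
    rw [← hy.inversionParity_eq_zero_iff, inversionParity_mul, hx.inv, h, wz, add_zero]
  have h2 : cs.inversionParity (w * x * y) x ≠ 0 := by
    rw [hx.inversionParity_ne_zero_iff, show w * x * y * x = w * (x * y * x) by group, hwz]
    omega
  have h3 : cs.inversionParity (w * y) x = cs.inversionParity y x := by
    rw [inversionParity_mul, hy.inv, ← hb, wz, add_zero]
  have h4 : cs.inversionParity (w * x) (x * y * x) = 0 ↔ cs.inversionParity (w * y) x = 0 := by
    rw [hz.inversionParity_eq_zero_iff, hx.inversionParity_eq_zero_iff, hwx, hwy,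
      show w * x * (x * y * x) = w * (x * x) * (y * x) by group, hx.mul_self, mul_one, mul_assoc]
  rw [inversionParity_mul, hy.inv, ← hb, ← h3] at h2
  have key : ∀ a b : ZMod 2, b + a ≠ 0 → (a = 0 ↔ b = 0) → False := by decide
  exact key _ _ h2 h4

end CoxeterSystem

/-- **Diamond lemma obstruction** (Lemma `lem:diamond` of the paper). Let `(W, S)` be a Coxeter
system with length function `ℓ`, let `t, t'` be reflections such that `t * t'` has order `3`,
and set `t'' = t * t' * t`. Suppose `w, wtil ∈ W` and that for two distinct elements `r₁, r₂` of
`{t, t', t''}` both `w * rᵢ` covers `w` (i.e. `ℓ (w * rᵢ) = ℓ w + 1`) and `w * rᵢ` is covered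
by `wtil` (i.e. `wtil = w * rᵢ * uᵢ` for some reflection `uᵢ` with `ℓ wtil = ℓ (w * rᵢ) + 1`). Then
the remaining third element `r₃` of `{t, t', t''}` satisfies `ℓ (w * r₃) ≠ ℓ w + 1`, i.e.
`w * r₃` does not cover `w`. -/
theorem diamond_lemma {B : Type*} {W : Type*} [Group W] {M : CoxeterMatrix B}
    (cs : CoxeterSystem M W) (t t' : W)
    (ht : cs.IsReflection t) (ht' : cs.IsReflection t')
    (horder : orderOf (t * t') = 3)
    (w wtil : W) (r₁ r₂ r₃ : W)
    (hset : ({r₁, r₂, r₃} : Set W) = {t, t', t * t' * t})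
    (h12 : r₁ ≠ r₂) (h13 : r₁ ≠ r₃) (h23 : r₂ ≠ r₃)
    (hcov₁ : cs.length (w * r₁) = cs.length w + 1)
    (hcov₂ : cs.length (w * r₂) = cs.length w + 1)
    (hup₁ : ∃ u₁ : W, cs.IsReflection u₁ ∧ wtil = w * r₁ * u₁ ∧
      cs.length wtil = cs.length (w * r₁) + 1)
    (hup₂ : ∃ u₂ : W, cs.IsReflection u₂ ∧ wtil = w * r₂ * u₂ ∧
      cs.length wtil = cs.length (w * r₂) + 1) :
    cs.length (w * r₃) ≠ cs.length w + 1 := by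
  intro hcov₃
  have hcov (r : W) (hr : r ∈ ({t, t', t * t' * t} : Set W)) :
      cs.length (w * r) = cs.length w + 1 := by
    rw [← hset] at hr
    rcases hr with rfl | rfl | rfl <;> assumption
  have hb : t * t' * t = t' * t * t' := by
    have h := pow_orderOf_eq_one (t * t')
    rw [horder] at h
    rw [← mul_left_inj (t' * t * t')]
    have e : t' * t * t' * (t' * t * t') = 1 := by
      rw [show t' * t * t' * (t' * t * t') = t' * t * (t' * t') * t * t' by group, ht'.mul_self,
        mul_one, mul_assoc t', ht.mul_self, mul_one, ht'.mul_self]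
    rw [e, ← h]
    simp [pow_succ, mul_assoc]
  set z := t * t' * t with hz
  have ht'' : cs.IsReflection z := by
    have := ht'.conj t
    rwa [ht.inv] at this
  have hc {x y : W} (hx : x * x = 1) : x * (x * y * x) * x = y := by
    rw [show x * (x * y * x) * x = x * x * y * (x * x) by group, hx, one_mul, mul_one]
  have htz : t * z * t = t' := hc ht.mul_self
  have ht'z : t' * z * t' = t := by rw [hb]; exact hc ht'.mul_self
  have hzt : z * t * z = t' := by
    calc z * t * z = t * (t' * (t * t) * t * t' * t) := by rw [hz]; group
      _ = t * (t' * t * t') * t := by rw [ht.mul_self, mul_one]; group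
      _ = t' := by rw [← hb, htz]
  have hzt' : z * t' * z = t := by
    calc z * t' * z = t' * (t * (t' * t') * t' * t * t') := by rw [hb]; group
      _ = t' * (t * t' * t) * t' := by rw [ht'.mul_self, mul_one]; group
      _ = t := ht'z
  have hrefl : ∀ x ∈ ({t, t', z} : Set W), cs.IsReflection x := by
    rintro x (rfl | rfl | rfl) <;> assumption
  have hbraid : ∀ x ∈ ({t, t', z} : Set W), ∀ y ∈ ({t, t', z} : Set W),
      x * y * x ∈ ({t, t', z} : Set W) ∧ (x ≠ y → x * y * x = y * x * y) := by
    simp [ht.mul_self, ht'.mul_self, ht''.mul_self, htz, ht'z, hzt, hzt', ← hz, ← hb]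
  have hne : t ≠ t' := by
    rintro rfl
    rw [ht.mul_self, orderOf_one] at horder
    omega
  obtain ⟨x, hx, y, hy, h⟩ := cs.exists_inversionParity_eq_zero {t, t', z}
    ⟨t, by simp, t', by simp, hne⟩ (fun x hx ↦ (hrefl x hx).mul_self)
    (fun x hx y hy ↦ (hbraid x hx y hy).1) ht (by simp)
  by_cases hxy : x = y
  · rw [← hxy, (hrefl x hx).inversionParity_self] at h
    exact one_ne_zero h
  · exact (hrefl x hx).inversionParity_ne_zero_of_covers (hrefl y hy) ((hbraid x hx y hy).2 hxy)
      (hcov x hx) (hcov y hy) (hcov _ (hbraid x hx y hy).1) h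
end
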